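/- In the blocked graph H (the least set of blocks over the skeleton of G closed under the rules R1–R4), for every cycle V1, …, Vn = V1 with consecutive nodes adjacent: if for some i the V_i-end of the edge V_i–V_{i+1} is blocked and its V_{i+1}-end is unblocked, then for some j the V_{j+1}-end of the edge V_j–V_{j+1} is blocked and its V_j-end is unblocked. -/

import Mathlib

/-- There is an edge between `a` and `b`: a directed edge `a → b`, a directed edge
`b → a`, or an undirected edge `a − b`. -/
def Adj (dir und : V → V → Prop) (a b : V) : Prop :=
  dir a b ∨ dir b a ∨ und a b ∨ und b a

/-- A hybrid graph: undirected edges are symmetric, there are no self loops, and there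
is at most one edge between any pair of distinct nodes. -/
def IsHybrid (dir und : V → V → Prop) : Prop :=
  (∀ a b, und a b → und b a) ∧
  (∀ a b, dir a b → a ≠ b) ∧
  (∀ a b, und a b → a ≠ b) ∧
  (∀ a b, dir a b → ¬ dir b a) ∧
  (∀ a b, dir a b → ¬ und a b ∧ ¬ und b a)

/-- Every pair of consecutive elements of the list `l` is related by `R`. -/
def ChainRel (R : V → V → Prop) (l : List V) : Prop :=
  ∀ (i : ℕ) (a b : V), l[i]? = some a → l[i + 1]? = some b → R a b

/-- The list `l` is a route in the graph, i.e. consecutive nodes are adjacent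
(and `l` is nonempty). -/
def IsRoute (dir und : V → V → Prop) (l : List V) : Prop :=
  l ≠ [] ∧ ChainRel (Adj dir und) l

/-- The list `l` is a descending route: every step is `a → b` or `a − b`. -/
def IsDescRouteList (dir und : V → V → Prop) (l : List V) : Prop :=
  l ≠ [] ∧ ChainRel (fun a b => dir a b ∨ und a b) l

/-- There is a descending route from `a` to `b`. -/
def DescRoute (dir und : V → V → Prop) (a b : V) : Prop :=
  ∃ l : List V, l.head? = some a ∧ l.getLast? = some b ∧
    ChainRel (fun x y => dir x y ∨ und x y) l

/-- The list `l` is a semidirected cycle. -/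
def SemidirectedCycle (dir und : V → V → Prop) (l : List V) : Prop :=
  2 ≤ l.length ∧ l.head? = l.getLast? ∧
  ChainRel (fun a b => dir a b ∨ und a b) l ∧
  ∃ (i : ℕ) (a b : V), l[i]? = some a ∧ l[i + 1]? = some b ∧ dir a b

/-- A chain graph is a hybrid graph with no semidirected cycle. -/
def IsChainGraph (dir und : V → V → Prop) : Prop :=
  IsHybrid dir und ∧ ∀ l : List V, ¬ SemidirectedCycle dir und l

/-- The parents of the set of nodes `X`. -/
def pa (dir : V → V → Prop) (X : Set V) : Set V :=
  {v | v ∉ X ∧ ∃ w ∈ X, dir v w}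

/-- The neighbors of the set of nodes `X`. -/
def nbr (und : V → V → Prop) (X : Set V) : Set V :=
  {v | v ∉ X ∧ ∃ w ∈ X, und v w}

/-- The adjacents of the set of nodes `X`. -/
def adSet (dir und : V → V → Prop) (X : Set V) : Set V :=
  {v | v ∉ X ∧ ∃ w ∈ X, Adj dir und v w}

/-- The descendants of the set of nodes `X`. -/
def de (dir und : V → V → Prop) (X : Set V) : Set V :=
  {v | v ∉ X ∧ ∃ w ∈ X, DescRoute dir und w v}

/-- The connectivity component of the node `a`: all nodes reachable from `a` by a
route whose edges are all undirected. -/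
def co (und : V → V → Prop) (a : V) : Set V :=
  {b | Relation.ReflTransGen und a b}

/-- `b` is a head-no-tail node in the subroute `a, b, c`, i.e. the subroute is of
the form `a → b ← c`, `a → b − c` or `a − b ← c`. -/
def HeadNoTail (dir und : V → V → Prop) (a b c : V) : Prop :=
  (dir a b ∧ dir c b) ∨ (dir a b ∧ und b c) ∨ (und a b ∧ dir c b)

/-- The route `l` is `Z`-open: every head-no-tail (occurrence of a) node is in `Z`
and every other (occurrence of a) node is not in `Z`. -/
def ZOpen (dir und : V → V → Prop) (Z : Set V) (l : List V) : Prop :=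
  ChainRel (Adj dir und) l ∧
  (∀ (i : ℕ) (a b c : V), l[i]? = some a → l[i + 1]? = some b → l[i + 2]? = some c →
    (HeadNoTail dir und a b c ↔ b ∈ Z)) ∧
  (∀ a, l.head? = some a → a ∉ Z) ∧
  (∀ a, l.getLast? = some a → a ∉ Z)

/-- `X` is separated from `Y` given `Z`: there is no `Z`-open route between a node
of `X` and a node of `Y`. -/
def Separ (dir und : V → V → Prop) (X Y Z : Set V) : Prop :=
  ¬ ∃ (l : List V) (x y : V), x ∈ X ∧ y ∈ Y ∧ l.head? = some x ∧ l.getLast? = some y ∧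
      ZOpen dir und Z l

/-- The graph has a triplex `({A,C},B)`: an induced subgraph of the form `A → B ← C`,
`A → B − C` or `A − B ← C`. -/
def Triplex (dir und : V → V → Prop) (A B C : V) : Prop :=
  A ≠ C ∧ ¬ Adj dir und A C ∧
  ((dir A B ∧ dir C B) ∨ (dir A B ∧ und B C) ∨ (und A B ∧ dir C B))

/-- The graph has an immorality `A → B ← C`. -/
def Immorality (dir und : V → V → Prop) (A B C : V) : Prop :=
  A ≠ C ∧ ¬ Adj dir und A C ∧ dir A B ∧ dir C B

/-- The graph has a flag `A → B − C`. -/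
def FlagIn (dir und : V → V → Prop) (A B C : V) : Prop :=
  A ≠ C ∧ ¬ Adj dir und A C ∧ dir A B ∧ und B C

/-- The least set of blocks over the skeleton of the graph closed under the rules
R1-R4. `Blocked dir und S a b` means that the `a`-end of the edge `a - b` is blocked.
`S A B` is the fixed separator found for the nonadjacent pair `{A, B}`. -/
inductive Blocked (dir und : V → V → Prop) (S : V → V → Set V) : V → V → Prop where
  /-- R1 blocks the `A`-end of the edge `A - B`. -/
  | R1a (A B C : V) : Adj dir und A B → Adj dir und B C → A ≠ C → ¬ Adj dir und A C →
      B ∉ S A C → Blocked dir und S A B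
  /-- R1 blocks the `C`-end of the edge `B - C`. -/
  | R1b (A B C : V) : Adj dir und A B → Adj dir und B C → A ≠ C → ¬ Adj dir und A C →
      B ∉ S A C → Blocked dir und S C B
  | R2 (A B C : V) : Blocked dir und S A B → Adj dir und B C → A ≠ C → ¬ Adj dir und A C →
      B ∈ S A C → Blocked dir und S B C
  | R3 (A B : V) (l : List V) : l.head? = some A → l.getLast? = some B → 2 ≤ l.length →
      (∀ (i : ℕ) (a b : V), l[i]? = some a → l[i + 1]? = some b → Adj dir und a b) →
      (∀ (i : ℕ) (a b : V), l[i]? = some a → l[i + 1]? = some b → Blocked dir und S a b) →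
      Adj dir und A B → Blocked dir und S A B
  | R4 (A B C D : V) : Adj dir und A B → Adj dir und A C → Adj dir und A D →
      Adj dir und C B → Adj dir und D B → Blocked dir und S C B → Blocked dir und S D B →
      C ≠ D → ¬ Adj dir und C D → A ∈ S C D → B ∉ S C D → Blocked dir und S A B

/-- The directed edges of the hybrid graph `H'` obtained from the closed blocked graph:
an edge whose `a`-end is blocked and whose `b`-end is unblocked is directed as `a → b`. -/
def blkDir (dir und : V → V → Prop) (S : V → V → Set V) (a b : V) : Prop :=
  Adj dir und a b ∧ Blocked dir und S a b ∧ ¬ Blocked dir und S b a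

/-- The undirected edges of the hybrid graph `H'` obtained from the closed blocked graph:
an edge with both ends blocked or both ends unblocked is undirected. -/
def blkUnd (dir und : V → V → Prop) (S : V → V → Set V) (a b : V) : Prop :=
  Adj dir und a b ∧ (Blocked dir und S a b ↔ Blocked dir und S b a)

section Walks

variable {V : Type*} {R : V → V → Prop}

/-- There is a walk of length `n` from `x` to `y` whose steps are all related by `R`. -/
def StepsOfLength (R : V → V → Prop) (n : ℕ) (x y : V) : Prop :=
  ∃ p : ℕ → V, p 0 = x ∧ p n = y ∧ ∀ i < n, R (p i) (p (i + 1))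

theorem StepsOfLength.trans {m n : ℕ} {x y z : V} (h₁ : StepsOfLength R m x y)
    (h₂ : StepsOfLength R n y z) : StepsOfLength R (m + n) x z := by
  obtain ⟨p, hp0, hpm, hp⟩ := h₁
  obtain ⟨q, hq0, hqn, hq⟩ := h₂
  refine ⟨fun i => if i < m then p i else q (i - m), ?_, by simp [hqn], ?_⟩
  · rcases Nat.eq_zero_or_pos m with rfl | hm
    · simp [hq0, ← hpm, hp0]
    · simp [hm, hp0]
  · intro i hi
    rcases lt_trichotomy (i + 1) m with h | h | h
    · simpa [h, Nat.lt_of_succ_lt h] using hp i (by omega)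
    · have h' := hp i (by omega)
      rw [h, hpm, ← hq0] at h'
      simpa [h, show i < m by omega] using h'
    · have h' := hq (i - m) (by omega)
      rw [show i - m + 1 = i + 1 - m by omega] at h'
      simpa [show ¬ i < m by omega, show ¬ i + 1 < m by omega] using h'

theorem StepsOfLength.single {x y : V} (h : R x y) : StepsOfLength R 1 x y :=
  ⟨fun i => if i = 0 then x else y, by simp, by simp, by simpa using h⟩

theorem StepsOfLength.segment {n : ℕ} {p : ℕ → V} (hp : ∀ i < n, R (p i) (p (i + 1)))
    {i j : ℕ} (hij : i ≤ j) (hj : j ≤ n) : StepsOfLength R (j - i) (p i) (p j) := by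
  refine ⟨fun k => p (i + k), by simp, by simp [hij], fun k hk => ?_⟩
  simpa [add_assoc] using hp (i + k) (by omega)

theorem Relation.ReflTransGen.exists_stepsOfLength {x y : V} (h : Relation.ReflTransGen R x y) :
    ∃ n, StepsOfLength R n x y := by
  induction h with
  | refl => exact ⟨0, fun _ => x, rfl, rfl, by simp⟩
  | tail _ h ih =>
    obtain ⟨n, hn⟩ := ih
    exact ⟨n + 1, hn.trans (.single h)⟩

theorem StepsOfLength.reflTransGen {n : ℕ} {x y : V} (h : StepsOfLength R n x y) :
    Relation.ReflTransGen R x y := by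
  obtain ⟨p, rfl, rfl, hp⟩ := h
  induction n with
  | zero => exact .refl
  | succ n ih => exact (ih fun i hi => hp i (by omega)).tail (hp n (by omega))

theorem ChainRel.reflTransGen {l : List V} (h : ChainRel R l) {i j : ℕ} (hij : i ≤ j)
    (hj : j < l.length) : Relation.ReflTransGen R (l[i]'(by omega)) l[j] := by
  induction j, hij using Nat.le_induction with
  | base => exact .refl
  | succ j hij ih => exact (ih (by omega)).tail (h j _ _ (by simp) (by simp))

end Walks

section Blocks

variable {V : Type*} {dir und : V → V → Prop} {S : V → V → Set V}

theorem Adj.symm {a b : V} (h : Adj dir und a b) : Adj dir und b a := by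
  unfold Adj at *
  tauto

theorem IsHybrid.ne_of_adj (h : IsHybrid dir und) {a b : V} (hab : Adj dir und a b) : a ≠ b := by
  obtain ⟨-, hd, hu, -⟩ := h
  rcases hab with h | h | h | h
  exacts [hd _ _ h, (hd _ _ h).symm, hu _ _ h, (hu _ _ h).symm]

theorem Blocked.adj {a b : V} (h : Blocked dir und S a b) : Adj dir und a b := by
  cases h with
  | R1a _ _ _ h => exact h
  | R1b _ _ _ _ h => exact h.symm
  | R2 _ _ _ _ h => exact h
  | R3 _ _ _ _ _ _ _ _ h => exact h
  | R4 _ _ _ _ h => exact h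

theorem Blocked.of_reflTransGen (hG : IsHybrid dir und) {a b : V}
    (h : Relation.ReflTransGen (Blocked dir und S) a b) (hab : Adj dir und a b) :
    Blocked dir und S a b := by
  obtain ⟨n, p, rfl, rfl, hp⟩ := h.exists_stepsOfLength
  have hn : n ≠ 0 := by
    rintro rfl
    exact hG.ne_of_adj hab rfl
  have hb : ∀ (i : ℕ) (a b : V), ((List.range (n + 1)).map p)[i]? = some a →
      ((List.range (n + 1)).map p)[i + 1]? = some b → Blocked dir und S a b := by
    intro i a b ha hb
    simp only [List.getElem?_map, Option.map_eq_some_iff, List.getElem?_eq_some_iff,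
      List.length_range, List.getElem_range] at ha hb
    obtain ⟨_, ⟨hi, rfl⟩, rfl⟩ := ha
    obtain ⟨_, ⟨hi', rfl⟩, rfl⟩ := hb
    exact hp i (by omega)
  refine .R3 _ _ ((List.range (n + 1)).map p) ?_ ?_ ?_ (fun i a b ha hb' => (hb i a b ha hb').adj)
    hb hab
  · simp [List.range_succ_eq_map]
  · simp [List.range_succ]
  · simp
    omega

theorem Blocked.trans (hG : IsHybrid dir und) {a b c : V} (h₁ : Blocked dir und S a b)
    (h₂ : Blocked dir und S b c) (hac : Adj dir und a c) : Blocked dir und S a c :=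
  .of_reflTransGen hG (.tail (.single h₁) h₂) hac

/-- A block entering an unshielded middle node propagates to one of the ends of the next edge. -/
theorem Blocked.next {a b c : V} (h : Blocked dir und S a b) (hbc : Adj dir und b c)
    (hne : a ≠ c) (hac : ¬ Adj dir und a c) :
    Blocked dir und S b c ∨ Blocked dir und S c b := by
  by_cases hb : b ∈ S a c
  · exact .inl (.R2 a b c h hbc hne hac hb)
  · exact .inr (.R1b a b c h.adj hbc hne hac hb)

/-- No triangle has a block on exactly one of its edges. -/
theorem Blocked.triangle (hG : IsHybrid dir und) (hS : ∀ a b : V, S a b = S b a) {a b : V}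
    (h : Blocked dir und S a b) {c : V} (hac : Adj dir und a c) (hbc : Adj dir und b c)
    (h₁ : ¬ Blocked dir und S a c) (h₂ : ¬ Blocked dir und S c a)
    (h₃ : ¬ Blocked dir und S b c) (h₄ : ¬ Blocked dir und S c b) : False := by
  have collider : ∀ {a b d : V}, Adj dir und a b → Adj dir und b d → a ≠ d →
      ¬ Adj dir und a d → b ∉ S a d → Adj dir und a c → Adj dir und b c →
      ¬ Blocked dir und S a c → ¬ Blocked dir und S b c → ¬ Blocked dir und S c b → False := by
    intro a b d hab hbd hne had hb hac hbc h₁ h₃ h₄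
    have hd : Blocked dir und S d b := .R1b a b d hab hbd hne had hb
    have hcd : Adj dir und c d := by
      by_contra hcd
      rcases hd.next hbc (by rintro rfl; exact had hac) (fun h => hcd h.symm) with h | h
      exacts [h₃ h, h₄ h]
    by_cases hc : c ∈ S a d
    · exact h₄ (.R4 c b a d hbc.symm hac.symm hcd hab hbd.symm (.R1a a b d hab hbd hne had hb) hd
        hne had hc hb)
    · exact h₁ (.R1a a c d hac hcd hne had hc)
  induction h with
  | R1a a b d hab hbd hne had hb => exact collider hab hbd hne had hb hac hbc h₁ h₃ h₄
  | R1b d b a hdb hba hne hda hb =>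
    exact collider hba.symm hdb.symm hne.symm (fun h => hda h.symm) (hS d a ▸ hb) hac hbc h₁ h₃ h₄
  | R2 d a b hda hab hne hdb ha ih =>
    have hdc : Adj dir und d c := by
      by_contra hdc
      rcases hda.next hac (by rintro rfl; exact hdb hbc.symm) hdc with h | h
      exacts [h₁ h, h₂ h]
    refine ih hdc hac (fun h => ?_) (fun h => h₂ (h.trans hG hda hac.symm)) h₁ h₂
    rcases h.next hbc.symm hne hdb with h | h
    exacts [h₄ h, h₃ h]
  | R3 a b l hhead hlast hlen _ hb hab ih =>
    have hl : l[l.length - 1]? = some b := by rwa [← List.getLast?_eq_getElem?]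
    have ha : l[0]? = some a := by rwa [← List.head?_eq_getElem?]
    obtain ⟨v, hv⟩ : ∃ v, l[l.length - 2]? = some v :=
      ⟨l[l.length - 2], List.getElem?_eq_getElem _⟩
    have hl' : l[l.length - 2 + 1]? = some b := by
      rwa [show l.length - 2 + 1 = l.length - 1 by omega]
    have hvb := hb _ _ _ hv hl'
    have hav : Relation.ReflTransGen (Blocked dir und S) a v := by
      have := ChainRel.reflTransGen (R := Blocked dir und S) hb (Nat.zero_le (l.length - 2))
        (by omega)
      obtain ⟨_, rfl⟩ := List.getElem?_eq_some_iff.1 ha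
      obtain ⟨_, rfl⟩ := List.getElem?_eq_some_iff.1 hv
      exact this
    have hvc : Adj dir und v c := by
      by_contra hvc
      rcases hvb.next hbc (by rintro rfl; exact h₄ hvb) hvc with h | h
      exacts [h₃ h, h₄ h]
    exact ih _ _ _ hv hl' hvc hbc (fun h => h₁ (.of_reflTransGen hG (hav.tail h) hac))
      (fun h => h₄ (h.trans hG hvb hbc.symm)) h₃ h₄
  | R4 a b e f hab hae haf heb hfb he hf hne hef ha hb _ _ =>
    have key : ∀ {x : V}, Blocked dir und S x b → Adj dir und x c := by
      intro x hx
      by_contra hxc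
      rcases hx.next hbc (by rintro rfl; exact h₄ hx) hxc with h | h
      exacts [h₃ h, h₄ h]
    by_cases hc : c ∈ S e f
    · exact h₄ (.R4 c b e f hbc.symm (key he).symm (key hf).symm heb hfb he hf hne hef hc hb)
    · exact h₁ (.R4 a c e f hac hae haf (key he) (key hf)
        (.R1a e c f (key he) (key hf).symm hne hef hc)
        (.R1b e c f (key he) (key hf).symm hne hef hc) hne hef ha hc)

/-- An edge that is not blocked only at its second end. -/
def WeakStep (dir und : V → V → Prop) (S : V → V → Set V) (a b : V) : Prop :=
  Adj dir und a b ∧ (Blocked dir und S b a → Blocked dir und S a b)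

theorem Blocked.not_weakStep_closed (hG : IsHybrid dir und) (hS : ∀ a b : V, S a b = S b a)
    (n : ℕ) {a b : V} (hab : Blocked dir und S a b) (hba : ¬ Blocked dir und S b a) :
    ¬ StepsOfLength (WeakStep dir und S) n b a := by
  induction n using Nat.strong_induction_on generalizing a b with
  | _ n ih =>
  rintro ⟨p, rfl, rfl, hp⟩
  match n with
  | 0 => exact hba hab
  | 1 => exact hba ((hp 0 (by omega)).2 hab)
  | 2 =>
    obtain ⟨h01, w01⟩ := hp 0 (by omega)
    obtain ⟨h12, w12⟩ := hp 1 (by omega)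
    simp only [Nat.reduceAdd] at h01 w01 h12 w12
    have ht : ∀ {x y z : V}, Blocked dir und S x y → Blocked dir und S y z → Adj dir und x z →
        Blocked dir und S x z := fun h₁ h₂ h => h₁.trans hG h₂ h
    have h01' : ¬ Blocked dir und S (p 0) (p 1) := fun h =>
      have h' : ¬ Blocked dir und S (p 1) (p 2) := fun h'' => hba (ht h h'' hab.adj.symm)
      h' (w12 (ht hab h h12.symm))
    have h12' : ¬ Blocked dir und S (p 1) (p 2) := fun h => h01' (w01 (ht h hab h01.symm))
    exact hab.triangle hG hS h12.symm h01 (mt w12 h12') h12' h01' (mt w01 h01')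
  | n + 3 =>
    have chord : ∀ i j, i + 2 ≤ j → j ≤ n + 3 → j - i < n + 3 →
        p i ≠ p j ∧ ¬ Adj dir und (p i) (p j) := by
      intro i j hij hj hlt
      have s₁ := StepsOfLength.segment hp (Nat.zero_le i) (by omega)
      have s₂ := StepsOfLength.segment hp hj le_rfl
      refine ⟨fun h => ?_, fun h => ?_⟩
      · rw [← h] at s₂
        exact ih _ (by omega) hab hba (s₁.trans s₂)
      · by_cases hw : WeakStep dir und S (p i) (p j)
        · exact ih _ (by omega) hab hba ((s₁.trans (.single hw)).trans s₂)
        · simp only [WeakStep, h, true_and, Classical.not_imp] at hw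
          exact ih _ hlt hw.1 hw.2 (StepsOfLength.segment hp (by omega) hj)
    have step : ∀ {x : V} {i : ℕ}, i < n + 3 → Blocked dir und S x (p i) → x ≠ p (i + 1) →
        ¬ Adj dir und x (p (i + 1)) → Blocked dir und S (p i) (p (i + 1)) := by
      intro x i hi hx hne hadj
      exact (hx.next (hp i hi).1 hne hadj).elim id (hp i hi).2
    have all : ∀ i < n + 3, Blocked dir und S (p i) (p (i + 1)) := by
      intro i
      induction i with
      | zero =>
        intro hi
        obtain ⟨hne, hadj⟩ := chord 1 (n + 3) (by omega) le_rfl (by omega)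
        exact step hi hab hne.symm fun h => hadj h.symm
      | succ i IH =>
        intro hi
        obtain ⟨hne, hadj⟩ := chord i (i + 2) le_rfl (by omega) (by omega)
        exact step hi (IH (by omega)) hne hadj
    exact hba (.of_reflTransGen hG (StepsOfLength.reflTransGen ⟨p, rfl, rfl, all⟩) hab.adj.symm)

end Blocks

theorem stmt_14 {V : Type} [Fintype V] (dir und : V → V → Prop)
    (hG : IsChainGraph dir und) (S : V → V → Set V)
    (hSsymm : ∀ A B : V, S A B = S B A)
    (hSsep : ∀ A B : V, A ≠ B → ¬ Adj dir und A B →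
      S A B ⊆ ({A, B} : Set V)ᶜ ∧ Separ dir und {A} {B} (S A B)) :
    ∀ l : List V, 2 ≤ l.length → l.head? = l.getLast? → ChainRel (Adj dir und) l →
    (∃ (i : ℕ) (a b : V), l[i]? = some a ∧ l[i + 1]? = some b ∧
        Blocked dir und S a b ∧ ¬ Blocked dir und S b a) →
    ∃ (j : ℕ) (a b : V), l[j]? = some a ∧ l[j + 1]? = some b ∧
        Blocked dir und S b a ∧ ¬ Blocked dir und S a b := by
  intro l hlen hclosed hl ⟨i, a, b, ha, hb, hab, hba⟩
  by_contra hno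
  have hw : ChainRel (WeakStep dir und S) l := fun j x y hx hy =>
    ⟨hl j x y hx hy, fun h => by_contra fun h' => hno ⟨j, x, y, hx, hy, h, h'⟩⟩
  obtain ⟨hi, rfl⟩ := List.getElem?_eq_some_iff.1 ha
  obtain ⟨hi', rfl⟩ := List.getElem?_eq_some_iff.1 hb
  have to_last := hw.reflTransGen (show i + 1 ≤ l.length - 1 by omega) (by omega)
  have from_head := hw.reflTransGen (Nat.zero_le i) hi
  have heq : l[l.length - 1] = l[0] := by
    rw [List.head?_eq_getElem?, List.getLast?_eq_getElem?,
      List.getElem?_eq_getElem (by omega), List.getElem?_eq_getElem (by omega)] at hclosed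
    exact (Option.some.inj hclosed).symm
  rw [heq] at to_last
  obtain ⟨n, hn⟩ := (to_last.trans from_head).exists_stepsOfLength
  exact hab.not_weakStep_closed hG.1 hSsymm n hba hn
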